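/- arXiv:1004.2612 — 4 statements merged into one kernel-verified Lean document; each statement's English description precedes it below -/
import Mathlib

section
/- Let G = (U,V;E) be a simple bipartite graph, and let u, u' ∈ U with d(u') ≤ d(u). Suppose v ∈ V satisfies u'v ∈ E and uv ∉ E. Then there exists a vertex v' ∈ V such that the swap on (u,u';v,v') is allowed, and the bipartite graph G' produced by this swap satisfies Γ_{G'}(v) = (Γ_G(v) \ {u'}) ∪ {u}, where Γ denotes the neighbourhood of a vertex. -/
/-- Number of edges of the bipartite graph with edge set `E` incident to `u ∈ U`
(the degree of `u`). -/
def degU {U V : Type*} [DecidableEq U] (E : Finset (U × V)) (u : U) : ℕ :=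
  (E.filter fun p => p.1 = u).card

/-- The degree of `v ∈ V` in the bipartite graph with edge set `E`. -/
def degV {U V : Type*} [DecidableEq V] (E : Finset (U × V)) (v : V) : ℕ :=
  (E.filter fun p => p.2 = v).card

/-- The neighbourhood `Γ(v) ⊆ U` of a vertex `v ∈ V`. -/
def nbrU {U V : Type*} [DecidableEq U] [DecidableEq V] (E : Finset (U × V)) (v : V) :
    Finset U :=
  (E.filter fun p => p.2 = v).image Prod.fst

/-- The swap on `(u₁,u₂; v₁,v₂)` is allowed in the bipartite graph with edge set `E`:
for some `j ∈ {1,2}`, the edges `(u₁,v_j), (u₂,v_{3-j})` are present and the edges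
`(u₁,v_{3-j}), (u₂,v_j)` are absent. -/
def SwapAllowed {U V : Type*} [DecidableEq U] [DecidableEq V] (E : Finset (U × V))
    (u₁ u₂ : U) (v₁ v₂ : V) : Prop :=
  ((u₁, v₁) ∈ E ∧ (u₂, v₂) ∈ E ∧ (u₁, v₂) ∉ E ∧ (u₂, v₁) ∉ E) ∨
  ((u₁, v₂) ∈ E ∧ (u₂, v₁) ∈ E ∧ (u₁, v₁) ∉ E ∧ (u₂, v₂) ∉ E)

/-- The result of performing the swap on `(u₁,u₂; v₁,v₂)`: the two present edges among
the four positions are replaced by the two absent ones (symmetric difference with the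
four positions). -/
def swapResult {U V : Type*} [DecidableEq U] [DecidableEq V] (E : Finset (U × V))
    (u₁ u₂ : U) (v₁ v₂ : V) : Finset (U × V) :=
  (E \ {(u₁, v₁), (u₁, v₂), (u₂, v₁), (u₂, v₂)}) ∪
    ({(u₁, v₁), (u₁, v₂), (u₂, v₁), (u₂, v₂)} \ E)

/-- `E'` is obtained from `E` by a single allowed swap. -/
def IsSwap {U V : Type*} [DecidableEq U] [DecidableEq V] (E E' : Finset (U × V)) : Prop :=
  ∃ u₁ u₂ v₁ v₂, SwapAllowed E u₁ u₂ v₁ v₂ ∧ E' = swapResult E u₁ u₂ v₁ v₂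

/-- `E` can be transformed into `E'` by a sequence of `m` swaps (each intermediate
edge set is a realization of the same bipartite degree sequence, since swaps
preserve all degrees). -/
def SwapChain {U V : Type*} [DecidableEq U] [DecidableEq V] (E E' : Finset (U × V))
    (m : ℕ) : Prop :=
  ∃ f : ℕ → Finset (U × V), f 0 = E ∧ f m = E' ∧ ∀ i < m, IsSwap (f i) (f (i + 1))

theorem mem_nbrU {U V : Type*} [DecidableEq U] [DecidableEq V] {E : Finset (U × V)}
    {v : V} {x : U} : x ∈ nbrU E v ↔ (x, v) ∈ E := by
  simp [nbrU]

theorem degU_lt_degU {U V : Type*} [DecidableEq U] {E : Finset (U × V)} {u u' : U} {v : V}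
    (hsub : ∀ w, (u, w) ∈ E → (u', w) ∈ E) (h1 : (u', v) ∈ E) (h2 : (u, v) ∉ E) :
    degU E u < degU E u' := by
  classical
  have hcard (x : U) : degU E x = ((E.filter fun p => p.1 = x).image Prod.snd).card := by
    refine (Finset.card_image_of_injOn ?_).symm
    rintro ⟨a, b⟩ ha ⟨c, d⟩ hc hbd
    simp_all
  rw [hcard, hcard]
  refine Finset.card_lt_card (Finset.ssubset_iff_of_subset ?_ |>.2 ⟨v, ?_, ?_⟩)
  · intro w hw
    simp only [Finset.mem_image, Finset.mem_filter, Prod.exists, exists_eq_right] at hw ⊢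
    grind
  · simpa using h1
  · simpa using h2

/-- Havel–Hakimi lemma. Let `G = (U,V;E)` be a simple bipartite graph
and `u, u' ∈ U` with `d(u') ≤ d(u)`. Suppose `v ∈ V` satisfies `u'v ∈ E` and `uv ∉ E`.
Then there exists `v' ∈ V` such that the swap on `(u,u'; v,v')` is allowed, and the
graph `G'` produced by this swap satisfies `Γ_{G'}(v) = (Γ_G(v) \ {u'}) ∪ {u}`. -/
theorem havel_hakimi_swap {U V : Type*} [DecidableEq U] [DecidableEq V]
    (E : Finset (U × V)) (u u' : U) (v : V)
    (hdeg : degU E u' ≤ degU E u) (h1 : (u', v) ∈ E) (h2 : (u, v) ∉ E) :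
    ∃ v' : V, SwapAllowed E u u' v v' ∧
      nbrU (swapResult E u u' v v') v = (nbrU E v \ {u'}) ∪ {u} := by
  obtain ⟨v', hv, hv'⟩ : ∃ w, (u, w) ∈ E ∧ (u', w) ∉ E := by
    by_contra! hsub
    exact (degU_lt_degU hsub h1 h2).not_ge hdeg
  refine ⟨v', Or.inr ⟨hv, h1, h2, hv'⟩, ?_⟩
  have hne : v ≠ v' := fun h => h2 (h ▸ hv)
  ext x
  simp only [mem_nbrU, swapResult, Finset.mem_union, Finset.mem_sdiff, Finset.mem_insert,
    Finset.mem_singleton, Prod.mk.injEq]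
  grind
end

section
/- (Ryser) Let G_1 = (U,V;E_1) and G_2 = (U,V;E_2) be two realizations of the same bipartite degree sequence. Then there exists a finite sequence of swaps which transforms G_1 into G_2, passing only through realizations of the same bipartite degree sequence. -/
section Ryser

variable {U V : Type*} [DecidableEq U]

theorem exists_mem_notMem_of_degU_eq {E₁ E₂ : Finset (U × V)} {u : U}
    (h : degU E₁ u = degU E₂ u) (hne : ¬ ∀ v, (u, v) ∈ E₁ ↔ (u, v) ∈ E₂) :
    ∃ v, (u, v) ∈ E₁ ∧ (u, v) ∉ E₂ := by
  by_contra! hsub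
  have heq : (E₁.filter fun p => p.1 = u) = E₂.filter fun p => p.1 = u := by
    refine Finset.eq_of_subset_of_card_le ?_ h.ge
    rintro ⟨x, v⟩ hp
    simp only [Finset.mem_filter] at hp ⊢
    obtain ⟨hp, rfl⟩ := hp
    exact ⟨hsub v hp, rfl⟩
  refine hne fun v => ?_
  simpa using Finset.ext_iff.1 heq (u, v)

variable [DecidableEq V]

/-- Two realizations are connected when a finite sequence of swaps leads from one to the other. -/
def SwapConnected (E E' : Finset (U × V)) : Prop :=
  Relation.ReflTransGen IsSwap E E'

/-- The positions in row `u` at which `E` and `E'` disagree. -/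
def rowDiff (E E' : Finset (U × V)) (u : U) : Finset (U × V) :=
  (symmDiff E E').filter fun p => p.1 = u

theorem rowDiff_comm (E E' : Finset (U × V)) (u : U) : rowDiff E E' u = rowDiff E' E u := by
  rw [rowDiff, rowDiff, symmDiff_comm]

theorem mem_swapResult {E : Finset (U × V)} {u u' : U} {v w : V} (huv : (u, v) ∈ E)
    (huw' : (u', w) ∈ E) (huw : (u, w) ∉ E) (huv' : (u', v) ∉ E) (p : U × V) :
    p ∈ swapResult E u u' v w ↔
      p = (u, w) ∨ p = (u', v) ∨ (p ∈ E ∧ p ≠ (u, v) ∧ p ≠ (u', w)) := by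
  simp only [swapResult, Finset.mem_union, Finset.mem_sdiff, Finset.mem_insert,
    Finset.mem_singleton]
  grind

theorem swapResult_swapResult (E : Finset (U × V)) (u u' : U) (v w : V) :
    swapResult (swapResult E u u' v w) u u' v w = E := by
  ext p
  simp only [swapResult, Finset.mem_union, Finset.mem_sdiff]
  tauto

theorem SwapAllowed.swapResult {E : Finset (U × V)} {u u' : U} {v w : V}
    (h : SwapAllowed E u u' v w) : SwapAllowed (swapResult E u u' v w) u u' v w := by
  simp only [SwapAllowed] at h
  rcases h with ⟨h₁, h₂, h₃, h₄⟩ | ⟨h₁, h₂, h₃, h₄⟩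
  · exact .inr (by simp [_root_.swapResult, h₁, h₂, h₃, h₄])
  · exact .inl (by simp [_root_.swapResult, h₁, h₂, h₃, h₄])

theorem IsSwap.symm {E E' : Finset (U × V)} (h : IsSwap E E') : IsSwap E' E := by
  obtain ⟨u, u', v, w, h, rfl⟩ := h
  exact ⟨u, u', v, w, h.swapResult, (swapResult_swapResult E u u' v w).symm⟩

theorem SwapConnected.exists_swapChain {E E' : Finset (U × V)} (h : SwapConnected E E') :
    ∃ m, SwapChain E E' m := by
  induction h using Relation.ReflTransGen.head_induction_on with
  | refl => exact ⟨0, fun _ => E', rfl, rfl, by simp⟩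
  | @head E _ hs _ ih =>
    obtain ⟨m, f, rfl, rfl, hf⟩ := ih
    refine ⟨m + 1, fun | 0 => E | n + 1 => f n, rfl, rfl, fun i hi => ?_⟩
    cases i with
    | zero => exact hs
    | succ i => exact hf i (by omega)

theorem sum_swapResult {E : Finset (U × V)} {u u' : U} {v w : V} (huv : (u, v) ∈ E)
    (huw' : (u', w) ∈ E) (huw : (u, w) ∉ E) (huv' : (u', v) ∉ E) (f : U × V → ℕ)
    (hf : f (u, v) + f (u', w) = f (u, w) + f (u', v)) :
    ∑ p ∈ swapResult E u u' v w, f p = ∑ p ∈ E, f p := by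
  have hE' : swapResult E u u' v w =
      insert (u, w) (insert (u', v) ((E.erase (u, v)).erase (u', w))) := by
    ext p
    rw [mem_swapResult huv huw' huw huv']
    simp only [Finset.mem_insert, Finset.mem_erase]
    tauto
  have hne : u ≠ u' := by rintro rfl; exact huv' huv
  rw [hE', Finset.sum_insert (by simp [huw, hne]), Finset.sum_insert (by simp [huv']),
    ← Finset.add_sum_erase E f huv,
    ← Finset.add_sum_erase (E.erase (u, v)) f (a := (u', w)) (by simp [huw', hne.symm])]
  omega

theorem swapResult_comm_right (E : Finset (U × V)) (u u' : U) (v w : V) :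
    swapResult E u u' v w = swapResult E u u' w v := by
  ext p
  simp only [swapResult, Finset.mem_union, Finset.mem_sdiff, Finset.mem_insert,
    Finset.mem_singleton]
  tauto

theorem IsSwap.sum_eq {E E' : Finset (U × V)} (h : IsSwap E E') (f : U × V → ℕ)
    (hf : ∀ u u' v w, f (u, v) + f (u', w) = f (u, w) + f (u', v)) :
    ∑ p ∈ E', f p = ∑ p ∈ E, f p := by
  obtain ⟨u, u', v, w, ⟨h₁, h₂, h₃, h₄⟩ | ⟨h₁, h₂, h₃, h₄⟩, rfl⟩ := h
  · exact sum_swapResult h₁ h₂ h₃ h₄ f (hf ..)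
  · rw [swapResult_comm_right]
    exact sum_swapResult h₁ h₂ h₃ h₄ f (hf ..)

theorem IsSwap.degU_eq {E E' : Finset (U × V)} (h : IsSwap E E') (x : U) :
    degU E' x = degU E x := by
  simp only [degU, Finset.card_filter]
  exact h.sum_eq _ fun _ _ _ _ => rfl

theorem IsSwap.degV_eq {E E' : Finset (U × V)} (h : IsSwap E E') (x : V) :
    degV E' x = degV E x := by
  simp only [degV, Finset.card_filter]
  exact h.sum_eq _ fun _ _ _ _ => add_comm _ _

theorem degV_eq_card_add_card (E : Finset (U × V)) (T : Finset U) (v : V) :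
    degV E v = (T.filter fun x => (x, v) ∈ E).card +
      (E.filter fun p => p.2 = v ∧ p.1 ∉ T).card := by
  rw [degV, ← Finset.card_filter_add_card_filter_not (fun p : U × V => p.1 ∈ T),
    Finset.filter_filter, Finset.filter_filter]
  congr 1
  symm
  refine Finset.card_bij (fun x _ => (x, v)) ?_ ?_ ?_
  · simp +contextual
  · simp
  · rintro ⟨x, y⟩ h
    simp only [Finset.mem_filter] at h
    obtain ⟨h, rfl, hT⟩ := h
    exact ⟨x, by simp [h, hT], rfl⟩

/-- Realizations agreeing outside the rows `T` have equal column sums inside `T`. -/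
theorem card_filter_mem_eq {E₁ E₂ : Finset (U × V)} {T : Finset U}
    (hT : ∀ p : U × V, p.1 ∉ T → (p ∈ E₁ ↔ p ∈ E₂)) {v : V} (hV : degV E₁ v = degV E₂ v) :
    (T.filter fun x => (x, v) ∈ E₁).card = (T.filter fun x => (x, v) ∈ E₂).card := by
  rw [degV_eq_card_add_card E₁ T, degV_eq_card_add_card E₂ T] at hV
  have : (E₁.filter fun p => p.2 = v ∧ p.1 ∉ T) = E₂.filter fun p => p.2 = v ∧ p.1 ∉ T := by
    ext p
    simp only [Finset.mem_filter]
    have := hT p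
    tauto
  rw [this] at hV
  omega

/-- If `(u, v)` is an edge, `(u, w)` is not, and column `w` has at least as many edges in the rows
`T` as column `v`, then some row of `T` completes a swap. -/
theorem exists_row_of_card_le {E : Finset (U × V)} {T : Finset U} {u : U} {v w : V}
    (hu : u ∈ T) (huv : (u, v) ∈ E) (huw : (u, w) ∉ E)
    (hle : (T.filter fun x => (x, v) ∈ E).card ≤ (T.filter fun x => (x, w) ∈ E).card) :
    ∃ u' ∈ T, (u', w) ∈ E ∧ (u', v) ∉ E := by
  by_contra! h
  refine hle.not_gt (Finset.card_lt_card ((Finset.ssubset_iff_of_subset ?_).2 ⟨u, ?_, ?_⟩))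
  · intro x hx
    simp only [Finset.mem_filter] at hx ⊢
    exact ⟨hx.1, h x hx.1 hx.2⟩
  · simp [hu, huv]
  · simp [huw]

theorem exists_isSwap_rowDiff_lt_of_card_le {E₁ E₂ : Finset (U × V)} {T : Finset U} {u : U}
    {v w : V} (hT : ∀ p : U × V, p.1 ∉ T → (p ∈ E₁ ↔ p ∈ E₂)) (hu : u ∈ T)
    (hv₁ : (u, v) ∈ E₁) (hv₂ : (u, v) ∉ E₂) (hw₁ : (u, w) ∉ E₁) (hw₂ : (u, w) ∈ E₂)
    (hle : (T.filter fun x => (x, v) ∈ E₁).card ≤ (T.filter fun x => (x, w) ∈ E₁).card) :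
    ∃ E, IsSwap E₁ E ∧ (∀ p : U × V, p.1 ∉ T → (p ∈ E ↔ p ∈ E₂)) ∧
      (rowDiff E E₂ u).card < (rowDiff E₁ E₂ u).card := by
  obtain ⟨u', hu', huw', huv'⟩ := exists_row_of_card_le hu hv₁ hw₁ hle
  have hmem := mem_swapResult hv₁ huw' hw₁ huv'
  have hne : u ≠ u' := by rintro rfl; exact huv' hv₁
  refine ⟨swapResult E₁ u u' v w, ⟨u, u', v, w, .inl ⟨hv₁, huw', hw₁, huv'⟩, rfl⟩, ?_, ?_⟩
  · intro p hp
    rw [hmem, ← hT p hp]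
    grind
  · refine Finset.card_lt_card ((Finset.ssubset_iff_of_subset ?_).2 ⟨(u, v), ?_, ?_⟩)
    · intro p
      simp only [rowDiff, Finset.mem_filter, Finset.mem_symmDiff, hmem]
      grind
    · simp [rowDiff, Finset.mem_symmDiff, hv₁, hv₂]
    · simp only [rowDiff, Finset.mem_filter, Finset.mem_symmDiff, hmem]
      grind

theorem swapConnected_of_agree_off (T : Finset U) (E₁ E₂ : Finset (U × V))
    (hT : ∀ p : U × V, p.1 ∉ T → (p ∈ E₁ ↔ p ∈ E₂))
    (hU : ∀ u, degU E₁ u = degU E₂ u) (hV : ∀ v, degV E₁ v = degV E₂ v) :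
    SwapConnected E₁ E₂ := by
  induction T using Finset.induction_on generalizing E₁ E₂ with
  | empty =>
    obtain rfl : E₁ = E₂ := Finset.ext fun p => hT p (Finset.notMem_empty _)
    exact .refl
  | insert u T _ ihT =>
    induction hn : (rowDiff E₁ E₂ u).card using Nat.strong_induction_on generalizing E₁ E₂ with
    | _ n ihn =>
      subst hn
      by_cases hrow : ∀ v, (u, v) ∈ E₁ ↔ (u, v) ∈ E₂
      · refine ihT E₁ E₂ ?_ hU hV
        rintro ⟨x, v⟩ hx
        by_cases hxu : x = u
        · exact hxu ▸ hrow v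
        · exact hT _ (by simp [hxu, hx])
      · obtain ⟨v, hv₁, hv₂⟩ := exists_mem_notMem_of_degU_eq (hU u) hrow
        obtain ⟨w, hw₂, hw₁⟩ := exists_mem_notMem_of_degU_eq (hU u).symm
          fun h => hrow fun v => (h v).symm
        have hu := Finset.mem_insert_self u T
        have hcv := card_filter_mem_eq hT (hV v)
        have hcw := card_filter_mem_eq hT (hV w)
        rcases le_total ((insert u T).filter fun x => (x, v) ∈ E₁).card
          ((insert u T).filter fun x => (x, w) ∈ E₁).card with hle | hle
        · obtain ⟨E, hs, hE, hlt⟩ :=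
            exists_isSwap_rowDiff_lt_of_card_le hT hu hv₁ hv₂ hw₁ hw₂ hle
          exact .head hs (ihn _ hlt E E₂ hE (fun x => (hs.degU_eq x).trans (hU x))
            (fun x => (hs.degV_eq x).trans (hV x)) rfl)
        · rw [hcv, hcw] at hle
          obtain ⟨E, hs, hE, hlt⟩ := exists_isSwap_rowDiff_lt_of_card_le
            (fun p hp => (hT p hp).symm) hu hw₂ hw₁ hv₂ hv₁ hle
          rw [rowDiff_comm E, rowDiff_comm E₂] at hlt
          exact .tail (ihn _ hlt E₁ E (fun p hp => (hE p hp).symm)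
            (fun x => (hU x).trans (hs.degU_eq x).symm)
            (fun x => (hV x).trans (hs.degV_eq x).symm) rfl) hs.symm

end Ryser

/-- Ryser. Let `G₁ = (U,V;E₁)` and `G₂ = (U,V;E₂)` be two
realizations of the same bipartite degree sequence. Then there is a finite sequence
of swaps transforming `G₁` into `G₂` (passing only through realizations of the same
bipartite degree sequence, since swaps preserve all degrees). -/
theorem ryser {U V : Type*} [DecidableEq U] [DecidableEq V] (E₁ E₂ : Finset (U × V))
    (hU : ∀ u : U, degU E₁ u = degU E₂ u) (hV : ∀ v : V, degV E₁ v = degV E₂ v) :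
    ∃ m : ℕ, SwapChain E₁ E₂ m := by
  refine (swapConnected_of_agree_off ((E₁ ∪ E₂).image Prod.fst) E₁ E₂ ?_ hU hV).exists_swapChain
  intro p hp
  simp only [Finset.mem_image, Finset.mem_union, not_exists, not_and] at hp
  have := hp p
  tauto
end

section
/- Let G_1 = (U,V;E_1) and G_2 = (U,V;E_2) be two realizations of the same bipartite degree sequence, and let e = |E_1| = |E_2| be the number of edges. Then there exists a sequence of at most 2e swaps which transforms G_1 into G_2, passing only through realizations of the same bipartite degree sequence. -/
section Swaps

variable {U V : Type*} [DecidableEq U] [DecidableEq V]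

theorem SwapChain.refl (E : Finset (U × V)) : SwapChain E E 0 :=
  ⟨fun _ => E, rfl, rfl, by simp⟩

theorem SwapChain.cons {E E' E'' : Finset (U × V)} {m : ℕ} (h : IsSwap E E')
    (hc : SwapChain E' E'' m) : SwapChain E E'' (m + 1) := by
  obtain ⟨f, h0, hm, hf⟩ := hc
  refine ⟨fun i => Nat.casesOn i E f, rfl, hm, fun i hi => ?_⟩
  cases i with
  | zero => simpa [h0] using h
  | succ i => exact hf i (by omega)

theorem SwapChain.snoc {E E' E'' : Finset (U × V)} {m : ℕ} (hc : SwapChain E E' m)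
    (h : IsSwap E' E'') : SwapChain E E'' (m + 1) := by
  obtain ⟨f, h0, hm, hf⟩ := hc
  refine ⟨fun i => if i ≤ m then f i else E'', by simpa using h0, by simp, fun i hi => ?_⟩
  rcases Nat.lt_succ_iff_lt_or_eq.mp hi with hi | rfl
  · simpa [hi.le, Nat.succ_le_of_lt hi] using hf i hi
  · simpa [hm] using h

/-- Replacing the edges `(a, b)`, `(c, d)` by `(a, d)`, `(c, b)` on top of a common set `K` of
edges is an allowed swap. -/
theorem isSwap_insert {K : Finset (U × V)} {a c : U} {b d : V} (hac : a ≠ c) (hbd : b ≠ d)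
    (hab : (a, b) ∉ K) (hcd : (c, d) ∉ K) (had : (a, d) ∉ K) (hcb : (c, b) ∉ K) :
    IsSwap (insert (a, b) (insert (c, d) K)) (insert (a, d) (insert (c, b) K)) := by
  refine ⟨a, c, b, d, Or.inl ?_, ?_⟩
  · simp [hac.symm, hbd.symm, *]
  · ext p
    simp only [swapResult, Finset.mem_insert, Finset.mem_union, Finset.mem_sdiff,
      Finset.mem_singleton]
    grind

theorem degU_insert {K : Finset (U × V)} {p : U × V} (hp : p ∉ K) (u : U) :
    degU (insert p K) u = (if p.1 = u then 1 else 0) + degU K u := by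
  unfold degU
  rw [Finset.filter_insert]
  split_ifs <;> simp [hp, add_comm]

theorem degV_insert {K : Finset (U × V)} {p : U × V} (hp : p ∉ K) (v : V) :
    degV (insert p K) v = (if p.2 = v then 1 else 0) + degV K v := by
  unfold degV
  rw [Finset.filter_insert]
  split_ifs <;> simp [hp, add_comm]

/-- A pair of present edges `(a, b)`, `(c, d)` with `(a, d)`, `(c, b)` absent can be exchanged by a
reversible swap which keeps all degrees. -/
theorem exists_reversible_swap {E : Finset (U × V)} {a c : U} {b d : V} (hab : (a, b) ∈ E)
    (hcd : (c, d) ∈ E) (had : (a, d) ∉ E) (hcb : (c, b) ∉ E) :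
    ∃ E' : Finset (U × V), IsSwap E E' ∧ IsSwap E' E ∧ (∀ u, degU E' u = degU E u) ∧
      (∀ v, degV E' v = degV E v) ∧
      ∀ p, p ∈ E' ↔ p = (a, d) ∨ p = (c, b) ∨ (p ∈ E ∧ p ≠ (a, b) ∧ p ≠ (c, d)) := by
  have hac : a ≠ c := by rintro rfl; exact had hcd
  have hbd : b ≠ d := by rintro rfl; exact had hab
  set K := E \ {(a, b), (c, d)} with hK
  have h1 : (a, b) ∉ K := by simp [hK]
  have h2 : (c, d) ∉ K := by simp [hK]
  have h3 : (a, d) ∉ K := by simp [hK, had]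
  have h4 : (c, b) ∉ K := by simp [hK, hcb]
  have hE : E = insert (a, b) (insert (c, d) K) := by
    ext p
    simp only [hK, Finset.mem_insert, Finset.mem_sdiff, Finset.mem_singleton]
    grind
  have h12 : (a, b) ∉ insert (c, d) K := by simp [hac, h1]
  have h34 : (a, d) ∉ insert (c, b) K := by simp [hac, h3]
  refine ⟨insert (a, d) (insert (c, b) K), ?_, ?_, fun u => ?_, fun v => ?_, fun p => ?_⟩
  · rw [hE]
    exact isSwap_insert hac hbd h1 h2 h3 h4
  · rw [hE]
    exact isSwap_insert hac hbd.symm h3 h4 h1 h2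
  · rw [hE, degU_insert h12, degU_insert h34, degU_insert h2, degU_insert h4]
  · rw [hE, degV_insert h12, degV_insert h34, degV_insert h2, degV_insert h4]
    dsimp only
    omega
  · simp [hK]

theorem exists_mem_notMem_of_card_eq {α : Type*} {S T : Finset α} (h : S.card = T.card) {x : α}
    (hx : x ∈ S) (hxT : x ∉ T) : ∃ y ∈ T, y ∉ S := by
  by_contra! hTS
  exact hxT (Finset.eq_of_subset_of_card_le hTS h.le ▸ hx)

/-- Two different realizations contain an alternating path of length three in their symmetric
difference which is not closed by an edge of the first realization missing from the second. -/
theorem exists_alternating_path {E₁ E₂ : Finset (U × V)} (hU : ∀ u, degU E₁ u = degU E₂ u)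
    (hV : ∀ v, degV E₁ v = degV E₂ v) (hne : (E₁ \ E₂).Nonempty) :
    ∃ a b c d, (a, b) ∈ E₁ \ E₂ ∧ (a, d) ∈ E₂ \ E₁ ∧ (c, d) ∈ E₁ \ E₂ ∧ (c, b) ∉ E₁ \ E₂ := by
  let R : U → Finset V := fun u => ((E₁ \ E₂).filter fun p => p.1 = u).image Prod.snd
  have hR : ∀ u v, v ∈ R u ↔ (u, v) ∈ E₁ \ E₂ := by simp [R]
  obtain ⟨⟨a, v⟩, hav, hmax⟩ := Finset.exists_max_image (E₁ \ E₂) (fun p => (R p.1).card) hne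
  rw [Finset.mem_sdiff] at hav
  obtain ⟨⟨a', d⟩, hE₂, had'⟩ := exists_mem_notMem_of_card_eq (hU a) (x := (a, v))
    (by simp [hav.1]) (by simp [hav.2])
  obtain ⟨had, rfl : a' = a⟩ := Finset.mem_filter.mp hE₂
  replace had' : (a', d) ∉ E₁ := by simpa using had'
  obtain ⟨⟨c, d'⟩, hE₁, hcd'⟩ := exists_mem_notMem_of_card_eq (hV d).symm (x := (a', d))
    (by simp [had]) (by simp [had'])
  obtain ⟨hcd, rfl : d' = d⟩ := Finset.mem_filter.mp hE₁
  replace hcd' : (c, d') ∉ E₂ := by simpa using hcd'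
  have hcdR : (c, d') ∈ E₁ \ E₂ := Finset.mem_sdiff.mpr ⟨hcd, hcd'⟩
  by_cases hsub : R a' ⊆ R c
  · refine absurd (hmax _ hcdR) (not_le.mpr (Finset.card_lt_card ⟨hsub, fun h => ?_⟩))
    exact had' (Finset.mem_sdiff.mp ((hR _ _).mp (h ((hR _ _).mpr hcdR)))).1
  · obtain ⟨b, hb, hb'⟩ := Finset.not_subset.mp hsub
    exact ⟨a', b, c, d', (hR _ _).mp hb, Finset.mem_sdiff.mpr ⟨had, had'⟩, hcdR,
      fun h => hb' ((hR _ _).mpr h)⟩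

theorem card_lt_of_subset_insert_sdiff_pair {α : Type*} [DecidableEq α] {S T : Finset α}
    {x y z : α} (hx : x ∈ T) (hy : y ∈ T) (hxy : x ≠ y) (h : S ⊆ insert z (T \ {x, y})) :
    S.card < T.card := by
  have h1 := (Finset.card_le_card h).trans (Finset.card_insert_le _ _)
  have h2 : ({x, y} : Finset α) ⊆ T := by simp [Finset.insert_subset_iff, hx, hy]
  have h3 := Finset.card_sdiff_add_card_eq_card h2
  rw [Finset.card_pair hxy] at h3
  omega

theorem exists_swapChain_le_card_sdiff (n : ℕ) (E₁ E₂ : Finset (U × V))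
    (hU : ∀ u, degU E₁ u = degU E₂ u) (hV : ∀ v, degV E₁ v = degV E₂ v)
    (hn : (E₁ \ E₂).card ≤ n) : ∃ m ≤ n, SwapChain E₁ E₂ m := by
  induction n generalizing E₁ E₂ with
  | zero =>
    have hsub : E₁ ⊆ E₂ := by simpa [Finset.sdiff_eq_empty_iff_subset] using hn
    have heq : E₁ = E₂ := by
      refine hsub.antisymm fun p hp => ?_
      by_contra hp'
      obtain ⟨q, hq, hq'⟩ := exists_mem_notMem_of_card_eq (hU p.1).symm (x := p)
        (by simp [hp]) (by simp [hp'])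
      simp only [Finset.mem_filter] at hq hq'
      exact hq' ⟨hsub hq.1, hq.2⟩
    exact ⟨0, le_rfl, heq ▸ SwapChain.refl E₁⟩
  | succ n ih =>
    rcases (E₁ \ E₂).eq_empty_or_nonempty with hemp | hne
    · obtain ⟨m, hm, hc⟩ := ih E₁ E₂ hU hV (by simp [hemp])
      exact ⟨m, by omega, hc⟩
    obtain ⟨a, b, c, d, hab, had, hcd, hcb⟩ := exists_alternating_path hU hV hne
    have hne' : (a, b) ≠ (c, d) := by
      intro h
      rw [Prod.mk.injEq] at h
      rw [h.2] at hab
      exact (Finset.mem_sdiff.mp had).2 (Finset.mem_sdiff.mp hab).1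
    have hlt := fun S : Finset (U × V) =>
      card_lt_of_subset_insert_sdiff_pair (S := S) (z := (c, b)) hab hcd hne'
    simp only [Finset.mem_sdiff] at hab had hcd hcb
    by_cases hcb₁ : (c, b) ∈ E₁
    · have hcb₂ : (c, b) ∈ E₂ := by tauto
      obtain ⟨E', -, hs, hU', hV', hE'⟩ := exists_reversible_swap had.1 hcb₂ hab.2 hcd.2
      have hcard := hlt (E₁ \ E') fun p => by
        simp only [Finset.mem_insert, Finset.mem_sdiff, Finset.mem_singleton, hE']
        grind
      obtain ⟨m, hm, hc⟩ := ih E₁ E' (fun u => (hU u).trans (hU' u).symm)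
        (fun v => (hV v).trans (hV' v).symm) (by omega)
      exact ⟨m + 1, by omega, hc.snoc hs⟩
    · obtain ⟨E', hs, -, hU', hV', hE'⟩ := exists_reversible_swap hab.1 hcd.1 had.2 hcb₁
      have hcard := hlt (E' \ E₂) fun p => by
        simp only [Finset.mem_insert, Finset.mem_sdiff, Finset.mem_singleton, hE']
        grind
      obtain ⟨m, hm, hc⟩ := ih E' E₂ (fun u => (hU' u).trans (hU u))
        (fun v => (hV' v).trans (hV v)) (by omega)
      exact ⟨m + 1, by omega, hc.cons hs⟩

end Swaps

/-- Let `G₁ = (U,V;E₁)` and `G₂ = (U,V;E₂)` be two realizations of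
the same bipartite degree sequence and let `e = |E₁| = |E₂|`. Then there is a
sequence of at most `2e` swaps transforming `G₁` into `G₂` (passing only through
realizations of the same bipartite degree sequence, since swaps preserve degrees). -/
theorem ryser_bound {U V : Type*} [DecidableEq U] [DecidableEq V] (E₁ E₂ : Finset (U × V))
    (hU : ∀ u : U, degU E₁ u = degU E₂ u) (hV : ∀ v : V, degV E₁ v = degV E₂ v) :
    ∃ m : ℕ, m ≤ 2 * E₁.card ∧ SwapChain E₁ E₂ m := by
  obtain ⟨m, hm, hc⟩ := exists_swapChain_le_card_sdiff _ E₁ E₂ hU hV le_rfl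
  have hle : (E₁ \ E₂).card ≤ E₁.card := Finset.card_le_card Finset.sdiff_subset
  exact ⟨m, by omega, hc⟩
end

section
/- Let G and G' be two realizations of the same bipartite degree sequence on vertex classes U, V, and let W ⊆ U ∪ V be the set of endpoints of edges in E(G) △ E(G'). Then G can be transformed into G' by a sequence of at most 2·|E(G[W])| swaps, each of which involves only vertices of W, passing only through realizations of the same bipartite degree sequence; here G[W] denotes the subgraph of G induced by W. -/
/-- The set `W ∩ U` of `U`-endpoints of edges of the symmetric difference. -/
def diffU {U V : Type*} [DecidableEq U] [DecidableEq V] (E₁ E₂ : Finset (U × V)) :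
    Finset U :=
  ((E₁ \ E₂) ∪ (E₂ \ E₁)).image Prod.fst

/-- The set `W ∩ V` of `V`-endpoints of edges of the symmetric difference. -/
def diffV {U V : Type*} [DecidableEq U] [DecidableEq V] (E₁ E₂ : Finset (U × V)) :
    Finset V :=
  ((E₁ \ E₂) ∪ (E₂ \ E₁)).image Prod.snd

section LocalSwaps

variable {U V : Type*} [DecidableEq U] [DecidableEq V]

/-- `E'` is obtained from `E` by one allowed swap on vertices of `S` and `T`. -/
def IsLocalSwap (S : Finset U) (T : Finset V) (E E' : Finset (U × V)) : Prop :=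
  ∃ u₁ u₂ v₁ v₂, u₁ ∈ S ∧ u₂ ∈ S ∧ v₁ ∈ T ∧ v₂ ∈ T ∧
    SwapAllowed E u₁ u₂ v₁ v₂ ∧ E' = swapResult E u₁ u₂ v₁ v₂

/-- `E` can be transformed into `E'` by `m` swaps on vertices of `S` and `T`. -/
def LocalSwapChain (S : Finset U) (T : Finset V) (E E' : Finset (U × V)) (m : ℕ) : Prop :=
  ∃ f : ℕ → Finset (U × V), f 0 = E ∧ f m = E' ∧ ∀ i < m, IsLocalSwap S T (f i) (f (i + 1))

/-- The neighbours in `T` of the vertex `u`. -/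
def rowNbrs (T : Finset V) (E : Finset (U × V)) (u : U) : Finset V :=
  T.filter fun v => (u, v) ∈ E

/-- The neighbours in `S` of the vertex `v`. -/
def colNbrs (S : Finset U) (E : Finset (U × V)) (v : V) : Finset U :=
  S.filter fun u => (u, v) ∈ E

/-- `E` and `E'` coincide off `S × T` and have the same degrees inside `S × T`. -/
structure LocallyEquivalent (S : Finset U) (T : Finset V) (E E' : Finset (U × V)) : Prop where
  row : ∀ u ∈ S, (rowNbrs T E u).card = (rowNbrs T E' u).card
  col : ∀ v ∈ T, (colNbrs S E v).card = (colNbrs S E' v).card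
  off : ∀ p : U × V, ¬(p.1 ∈ S ∧ p.2 ∈ T) → (p ∈ E ↔ p ∈ E')

variable {S : Finset U} {T : Finset V} {E E' E'' : Finset (U × V)} {m : ℕ}

theorem LocallyEquivalent.symm (h : LocallyEquivalent S T E E') : LocallyEquivalent S T E' E :=
  ⟨fun u hu => (h.row u hu).symm, fun v hv => (h.col v hv).symm, fun p hp => (h.off p hp).symm⟩

theorem LocallyEquivalent.trans (h : LocallyEquivalent S T E E')
    (h' : LocallyEquivalent S T E' E'') : LocallyEquivalent S T E E'' :=
  ⟨fun u hu => (h.row u hu).trans (h'.row u hu), fun v hv => (h.col v hv).trans (h'.col v hv),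
    fun p hp => (h.off p hp).trans (h'.off p hp)⟩

theorem IsLocalSwap.symm (h : IsLocalSwap S T E E') : IsLocalSwap S T E' E := by
  obtain ⟨u₁, u₂, v₁, v₂, hu₁, hu₂, hv₁, hv₂, ha, rfl⟩ := h
  refine ⟨u₁, u₂, v₁, v₂, hu₁, hu₂, hv₁, hv₂, ?_, ?_⟩
  · have hflip : ∀ p ∈ ({(u₁, v₁), (u₁, v₂), (u₂, v₁), (u₂, v₂)} : Finset (U × V)),
        p ∈ swapResult E u₁ u₂ v₁ v₂ ↔ p ∉ E := fun p hp => by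
      simp only [swapResult, Finset.mem_union, Finset.mem_sdiff, hp, not_true, and_false,
        true_and, false_or]
    unfold SwapAllowed at ha ⊢
    rw [hflip _ (by simp), hflip _ (by simp), hflip _ (by simp), hflip _ (by simp)]
    tauto
  · ext p
    simp only [swapResult, Finset.mem_union, Finset.mem_sdiff]
    tauto

theorem IsLocalSwap.mono {T' : Finset V} (hT : T ⊆ T') (h : IsLocalSwap S T E E') :
    IsLocalSwap S T' E E' := by
  obtain ⟨u₁, u₂, v₁, v₂, hu₁, hu₂, hv₁, hv₂, h⟩ := h
  exact ⟨u₁, u₂, v₁, v₂, hu₁, hu₂, hT hv₁, hT hv₂, h⟩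

theorem LocalSwapChain.mono {T' : Finset V} (hT : T ⊆ T') (h : LocalSwapChain S T E E' m) :
    LocalSwapChain S T' E E' m := by
  obtain ⟨f, h0, hm, hf⟩ := h
  exact ⟨f, h0, hm, fun i hi => (hf i hi).mono hT⟩

theorem LocalSwapChain.head (h : IsLocalSwap S T E E') (h' : LocalSwapChain S T E' E'' m) :
    LocalSwapChain S T E E'' (m + 1) := by
  obtain ⟨f, h0, hm, hf⟩ := h'
  refine ⟨fun i => Nat.casesOn i E f, rfl, hm, fun i hi => ?_⟩
  cases i with
  | zero => simpa [h0] using h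
  | succ i => exact hf i (by omega)

theorem LocalSwapChain.tail (h : LocalSwapChain S T E E' m) (h' : IsLocalSwap S T E' E'') :
    LocalSwapChain S T E E'' (m + 1) := by
  obtain ⟨f, h0, hm, hf⟩ := h
  refine ⟨fun i => if i ≤ m then f i else E'', by simp [h0], by simp, fun i hi => ?_⟩
  rcases Nat.lt_or_ge i m with hlt | hge
  · simpa [hlt.le, Nat.succ_le_of_lt hlt] using hf i hlt
  · obtain rfl : i = m := by omega
    simpa [hm] using h'

theorem card_eq_of_exchange {α : Type*} [DecidableEq α] {A B : Finset α} {a b : α} (ha : a ∈ A)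
    (hb : b ∉ A) (h : ∀ c, c ∈ B ↔ c = b ∨ (c ∈ A ∧ c ≠ a)) : A.card = B.card := by
  have hB : B = insert b (A.erase a) := by
    ext c
    simp only [h, Finset.mem_insert, Finset.mem_erase]
    tauto
  rw [hB, Finset.card_insert_of_notMem (by simp [hb]), Finset.card_erase_add_one ha]

/-- If `x` is a neighbour of `v`, `y` is not, and `y` has at least as many neighbours as `x`,
then a swap replaces `x` by `y` in the neighbourhood of `v`. -/
theorem exists_localSwap {x y : U} {v : V} (hx : x ∈ S) (hy : y ∈ S) (hv : v ∈ T)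
    (hxv : (x, v) ∈ E) (hyv : (y, v) ∉ E)
    (hle : (rowNbrs T E x).card ≤ (rowNbrs T E y).card) :
    ∃ E', IsLocalSwap S T E E' ∧ LocallyEquivalent S T E E' ∧
      ∀ u, (u, v) ∈ E' ↔ u = y ∨ ((u, v) ∈ E ∧ u ≠ x) := by
  obtain ⟨w, hwy, hwx⟩ : ∃ w ∈ rowNbrs T E y, w ∉ rowNbrs T E x := by
    by_contra! hsub
    have heq := Finset.eq_of_subset_of_card_le hsub hle
    have : v ∈ rowNbrs T E y := by
      rw [heq]
      simp [rowNbrs, hv, hxv]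
    simp [rowNbrs, hyv] at this
  simp only [rowNbrs, Finset.mem_filter] at hwy hwx
  obtain ⟨hw, hyw⟩ := hwy
  have hxw : (x, w) ∉ E := fun h => hwx ⟨hw, h⟩
  have hxy : x ≠ y := by rintro rfl; exact hyv hxv
  have hvw : v ≠ w := by rintro rfl; exact hxw hxv
  have hmem : ∀ p : U × V, p ∈ swapResult E x y v w ↔
      p = (x, w) ∨ p = (y, v) ∨ (p ∈ E ∧ p ≠ (x, v) ∧ p ≠ (y, w)) := by
    intro p
    simp only [swapResult, Finset.mem_union, Finset.mem_sdiff, Finset.mem_insert,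
      Finset.mem_singleton]
    grind
  refine ⟨swapResult E x y v w, ⟨x, y, v, w, hx, hy, hv, hw, Or.inl ⟨hxv, hyw, hxw, hyv⟩, rfl⟩,
    ⟨fun u _ => ?_, fun t _ => ?_, fun p hp => ?_⟩, fun u => ?_⟩
  · by_cases hux : u = x
    · subst hux
      exact card_eq_of_exchange (a := v) (b := w) (by simp [rowNbrs, hv, hxv])
        (by simp [rowNbrs, hxw]) fun t => by
          simp only [rowNbrs, Finset.mem_filter, hmem]; grind
    · by_cases huy : u = y
      · subst huy
        exact card_eq_of_exchange (a := w) (b := v) (by simp [rowNbrs, hw, hyw])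
          (by simp [rowNbrs, hyv]) fun t => by
            simp only [rowNbrs, Finset.mem_filter, hmem]; grind
      · congr 1
        ext t
        simp [rowNbrs, hmem, hux, huy]
  · by_cases htv : t = v
    · subst htv
      exact card_eq_of_exchange (a := x) (b := y) (by simp [colNbrs, hx, hxv])
        (by simp [colNbrs, hyv]) fun u => by
          simp only [colNbrs, Finset.mem_filter, hmem]; grind
    · by_cases htw : t = w
      · subst htw
        exact card_eq_of_exchange (a := y) (b := x) (by simp [colNbrs, hy, hyw])
          (by simp [colNbrs, hxw]) fun u => by
            simp only [colNbrs, Finset.mem_filter, hmem]; grind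
      · congr 1
        ext u
        simp [colNbrs, hmem, htv, htw]
  · rw [hmem]
    grind
  · rw [hmem]
    grind

theorem LocallyEquivalent.of_insert {v : V} (hv : v ∉ T)
    (h : LocallyEquivalent S (insert v T) E E')
    (hvE : ∀ u ∈ S, (u, v) ∈ E ↔ (u, v) ∈ E') : LocallyEquivalent S T E E' := by
  refine ⟨fun u hu => ?_, fun t ht => h.col t (Finset.mem_insert_of_mem ht), fun p hp => ?_⟩
  · have := h.row u hu
    simp only [rowNbrs, Finset.filter_insert, ← hvE u hu] at this ⊢
    split_ifs at this
    · rwa [Finset.card_insert_of_notMem (by simp [hv]),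
        Finset.card_insert_of_notMem (by simp [hv]), Nat.add_right_cancel_iff] at this
    · exact this
  · obtain ⟨u, t⟩ := p
    by_cases hu : u ∈ S ∧ t = v
    · obtain ⟨hu, rfl⟩ := hu
      exact hvE u hu
    · exact h.off _ (by grind)

/-- Locally equivalent graphs are connected by at most as many swaps as there are edges
in `S × T`. -/
theorem LocallyEquivalent.exists_chain (S : Finset U) (T : Finset V) :
    ∀ E E' : Finset (U × V), LocallyEquivalent S T E E' →
      ∃ m ≤ ∑ v ∈ T, (colNbrs S E v).card, LocalSwapChain S T E E' m := by
  induction T using Finset.induction_on with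
  | empty =>
    intro E E' h
    obtain rfl : E = E' := Finset.ext fun p => h.off p (by simp)
    exact ⟨0, le_rfl, fun _ => E, rfl, rfl, by simp⟩
  | insert v T hv ih =>
    have key : ∀ (k : ℕ) (E E' : Finset (U × V)), LocallyEquivalent S (insert v T) E E' →
        (colNbrs S E v \ colNbrs S E' v).card ≤ k →
        ∃ m ≤ k + ∑ t ∈ T, (colNbrs S E t).card, LocalSwapChain S (insert v T) E E' m := by
      intro k
      induction k with
      | zero =>
        intro E E' h hk
        have heq : colNbrs S E v = colNbrs S E' v :=
          Finset.eq_of_subset_of_card_le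
            (Finset.sdiff_eq_empty_iff_subset.1 (Finset.card_eq_zero.1 (Nat.le_zero.1 hk)))
            (h.col v (Finset.mem_insert_self v T)).ge
        have hvE : ∀ u ∈ S, (u, v) ∈ E ↔ (u, v) ∈ E' := fun u hu => by
          simpa [colNbrs, hu] using Finset.ext_iff.1 heq u
        obtain ⟨m, hm, hc⟩ := ih E E' (h.of_insert hv hvE)
        exact ⟨m, by omega, hc.mono (Finset.subset_insert v T)⟩
      | succ k ihk =>
        intro E E' h hk
        by_cases hk' : (colNbrs S E v \ colNbrs S E' v).card ≤ k
        · obtain ⟨m, hm, hc⟩ := ihk E E' h hk'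
          exact ⟨m, by omega, hc⟩
        have hcard := h.col v (Finset.mem_insert_self v T)
        obtain ⟨x, hx⟩ : (colNbrs S E v \ colNbrs S E' v).Nonempty :=
          Finset.card_pos.1 (by omega)
        obtain ⟨y, hy⟩ : (colNbrs S E' v \ colNbrs S E v).Nonempty := by
          rw [← Finset.card_pos, ← Finset.card_sdiff_comm hcard]
          omega
        have hlt : ∀ A : Finset U, A ⊆ (colNbrs S E v \ colNbrs S E' v).erase x → A.card ≤ k := by
          intro A hA
          have := Finset.card_le_card hA
          rw [Finset.card_erase_of_mem hx] at this
          omega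
        simp only [colNbrs, Finset.mem_sdiff, Finset.mem_filter, not_and] at hx hy
        obtain ⟨⟨hxS, hxE⟩, hxE'⟩ := hx
        obtain ⟨⟨hyS, hyE'⟩, hyE⟩ := hy
        replace hxE' := hxE' hxS
        replace hyE := hyE hyS
        have hvT := Finset.mem_insert_self v T
        rcases le_total (rowNbrs (insert v T) E x).card (rowNbrs (insert v T) E y).card with
          hle | hle
        · obtain ⟨F, hs, hF, hFv⟩ := exists_localSwap hxS hyS hvT hxE hyE hle
          obtain ⟨m, hm, hc⟩ := ihk F E' (hF.symm.trans h) (hlt _ fun u => by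
            simp only [colNbrs, Finset.mem_sdiff, Finset.mem_filter, Finset.mem_erase, hFv]
            grind)
          have hsum : ∑ t ∈ T, (colNbrs S E t).card = ∑ t ∈ T, (colNbrs S F t).card :=
            Finset.sum_congr rfl fun t ht => hF.col t (Finset.mem_insert_of_mem ht)
          exact ⟨m + 1, by omega, hc.head hs⟩
        · rw [h.row x hxS, h.row y hyS] at hle
          obtain ⟨F, hs, hF, hFv⟩ := exists_localSwap hyS hxS hvT hyE' hxE' hle
          obtain ⟨m, hm, hc⟩ := ihk E F (h.trans hF) (hlt _ fun u => by
            simp only [colNbrs, Finset.mem_sdiff, Finset.mem_filter, Finset.mem_erase, hFv]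
            grind)
          exact ⟨m + 1, by omega, hc.tail hs.symm⟩
    intro E E' h
    rw [Finset.sum_insert hv]
    exact key _ E E' h (Finset.card_le_card Finset.sdiff_subset)

theorem sum_card_colNbrs (S : Finset U) (T : Finset V) (E : Finset (U × V)) :
    ∑ v ∈ T, (colNbrs S E v).card = (E.filter fun p => p.1 ∈ S ∧ p.2 ∈ T).card := by
  rw [Finset.card_eq_sum_card_fiberwise (f := Prod.snd) (t := T) (fun p hp => by
    simp only [Finset.coe_filter, Set.mem_ofPred_eq] at hp
    exact hp.2.2)]
  refine Finset.sum_congr rfl fun v hv => ?_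
  refine Finset.card_nbij' (fun u => (u, v)) Prod.fst ?_ ?_ ?_ ?_ <;>
    simp only [colNbrs, Set.MapsTo, Set.LeftInvOn, Finset.coe_filter, Set.mem_ofPred_eq] <;> grind

theorem card_rowNbrs_add (T : Finset V) (E : Finset (U × V)) (u : U) :
    (rowNbrs T E u).card + (E.filter fun p => p.1 = u ∧ p.2 ∉ T).card = degU E u := by
  rw [degU, ← Finset.card_filter_add_card_filter_not (s := E.filter fun p => p.1 = u)
    (fun p => p.2 ∈ T), Finset.filter_filter, Finset.filter_filter]
  congr 1
  refine Finset.card_nbij' (fun v => (u, v)) Prod.snd ?_ ?_ ?_ ?_ <;>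
    simp only [rowNbrs, Set.MapsTo, Set.LeftInvOn, Finset.coe_filter, Set.mem_ofPred_eq] <;> grind

theorem card_colNbrs_add (S : Finset U) (E : Finset (U × V)) (v : V) :
    (colNbrs S E v).card + (E.filter fun p => p.2 = v ∧ p.1 ∉ S).card = degV E v := by
  rw [degV, ← Finset.card_filter_add_card_filter_not (s := E.filter fun p => p.2 = v)
    (fun p => p.1 ∈ S), Finset.filter_filter, Finset.filter_filter]
  congr 1
  refine Finset.card_nbij' (fun u => (u, v)) Prod.fst ?_ ?_ ?_ ?_ <;>
    simp only [colNbrs, Set.MapsTo, Set.LeftInvOn, Finset.coe_filter, Set.mem_ofPred_eq] <;> grind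

theorem locallyEquivalent_iff (hU : ∀ u : U, degU E u = degU E' u)
    (hV : ∀ v : V, degV E v = degV E' v) :
    LocallyEquivalent S T E E' ↔
      ∀ p : U × V, ¬(p.1 ∈ S ∧ p.2 ∈ T) → (p ∈ E ↔ p ∈ E') := by
  refine ⟨fun h => h.off, fun hoff => ⟨fun u _ => ?_, fun v _ => ?_, hoff⟩⟩
  · have h : (E.filter fun p => p.1 = u ∧ p.2 ∉ T) = E'.filter fun p => p.1 = u ∧ p.2 ∉ T := by
      ext p
      have := hoff p
      simp only [Finset.mem_filter]
      tauto
    have h₁ := card_rowNbrs_add T E u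
    have h₂ := card_rowNbrs_add T E' u
    rw [h] at h₁
    have := hU u
    omega
  · have h : (E.filter fun p => p.2 = v ∧ p.1 ∉ S) = E'.filter fun p => p.2 = v ∧ p.1 ∉ S := by
      ext p
      have := hoff p
      simp only [Finset.mem_filter]
      tauto
    have h₁ := card_colNbrs_add S E v
    have h₂ := card_colNbrs_add S E' v
    rw [h] at h₁
    have := hV v
    omega

theorem mem_iff_mem_of_notMem_diff {p : U × V} (hp : ¬(p.1 ∈ diffU E E' ∧ p.2 ∈ diffV E E')) :
    p ∈ E ↔ p ∈ E' := by
  by_contra hne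
  have hd : p ∈ (E \ E') ∪ (E' \ E) := by
    simp only [Finset.mem_union, Finset.mem_sdiff]
    tauto
  exact hp ⟨Finset.mem_image_of_mem _ hd, Finset.mem_image_of_mem _ hd⟩

end LocalSwaps

/-- Let `G` and `G'` be two realizations of the same bipartite degree
sequence and let `W` be the set of endpoints of edges of `E(G) △ E(G')`. Then `G` can
be transformed into `G'` by a sequence of at most `2·|E(G[W])|` swaps, each involving
only vertices of `W`, passing only through realizations of the same degree sequence
(automatic, since swaps preserve all degrees); here `G[W]` is the subgraph of `G`
induced by `W`. -/
theorem ryser_local {U V : Type*} [DecidableEq U] [DecidableEq V] (E₁ E₂ : Finset (U × V))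
    (hU : ∀ u : U, degU E₁ u = degU E₂ u) (hV : ∀ v : V, degV E₁ v = degV E₂ v) :
    ∃ (m : ℕ) (f : ℕ → Finset (U × V)), f 0 = E₁ ∧ f m = E₂ ∧
      m ≤ 2 * (E₁.filter fun p => p.1 ∈ diffU E₁ E₂ ∧ p.2 ∈ diffV E₁ E₂).card ∧
      ∀ i < m, ∃ (u₁ u₂ : U) (v₁ v₂ : V),
        u₁ ∈ diffU E₁ E₂ ∧ u₂ ∈ diffU E₁ E₂ ∧ v₁ ∈ diffV E₁ E₂ ∧ v₂ ∈ diffV E₁ E₂ ∧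
        SwapAllowed (f i) u₁ u₂ v₁ v₂ ∧ f (i + 1) = swapResult (f i) u₁ u₂ v₁ v₂ := by
  obtain ⟨m, hm, f, h0, hfm, hf⟩ := LocallyEquivalent.exists_chain (diffU E₁ E₂) (diffV E₁ E₂)
    E₁ E₂ ((locallyEquivalent_iff hU hV).2 fun _ => mem_iff_mem_of_notMem_diff)
  rw [sum_card_colNbrs] at hm
  exact ⟨m, f, h0, hfm, by omega, hf⟩
end
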